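/- Let h be a homogeneous Hamiltonian on T'ℝ^d with complete flow Φ. Then the set of points which are T-periodic but not absolutely T-periodic for some T > 0, namely { (y, η) ∈ T'ℝ^d : there exists T > 0 with Φ(T; y, η) = (y, η) such that (y, η) is not absolutely T-periodic }, has Lebesgue measure zero in ℝ^{2d}. -/

import Mathlib

open Real Set Filter MeasureTheory
open scoped BigOperators Topology

noncomputable section

/-- The phase space `ℝ^d × ℝ^d`. -/
abbrev Phase (d : ℕ) := (Fin d → ℝ) × (Fin d → ℝ)

/-- `T'ℝ^d = ℝ^d × (ℝ^d ∖ {0})`. -/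
def Tprime (d : ℕ) : Set (Phase d) := {p | p.2 ≠ 0}

/-- The Hamiltonian vector field `(∂h/∂ξ, −∂h/∂x)` of `h`. -/
def hamField {d : ℕ} (h : Phase d → ℝ) (p : Phase d) : Phase d :=
  (fun j => fderiv ℝ h p (0, Pi.single j 1), fun j => - fderiv ℝ h p (Pi.single j 1, 0))

/-- `γ` solves Hamilton's equations `ẋ = h_ξ`, `ξ̇ = −h_x` on the set `I`. -/
def IsHamTrajOn {d : ℕ} (h : Phase d → ℝ) (γ : ℝ → Phase d) (I : Set ℝ) : Prop :=
  ∀ t ∈ I, HasDerivAt γ (hamField h (γ t)) t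

/-- `h` is a homogeneous Hamiltonian: smooth and positive on `T'ℝ^d`, and positively
homogeneous of degree 1 in `ξ`. -/
def HomHamiltonian {d : ℕ} (h : Phase d → ℝ) : Prop :=
  ContDiffOn ℝ (⊤ : ℕ∞) h (Tprime d) ∧
  (∀ p ∈ Tprime d, 0 < h p) ∧
  (∀ p ∈ Tprime d, ∀ c : ℝ, 0 < c → h (p.1, c • p.2) = c * h p)

/-- `Φ` is the complete flow of `h` on `T'ℝ^d`: it is smooth in `(t, y, η)`, starts at the
identity, stays in `T'ℝ^d`, solves Hamilton's equations for all time, and is the unique such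
trajectory through each point. -/
def IsCompleteFlow {d : ℕ} (h : Phase d → ℝ) (Φ : ℝ → Phase d → Phase d) : Prop :=
  ContDiffOn ℝ (⊤ : ℕ∞) (fun q : ℝ × Phase d => Φ q.1 q.2) (Set.univ ×ˢ Tprime d) ∧
  ∀ p ∈ Tprime d,
    Φ 0 p = p ∧ (∀ t : ℝ, Φ t p ∈ Tprime d) ∧
    IsHamTrajOn h (fun t => Φ t p) Set.univ ∧
    (∀ γ : ℝ → Phase d, γ 0 = p → (∀ t : ℝ, γ t ∈ Tprime d) →
      IsHamTrajOn h γ Set.univ → γ = fun t => Φ t p)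

/-- The function `(y, η) ↦ |x*(T; y, η) − y|² + |ξ*(T; y, η) − η|²`. -/
def periodDefect {d : ℕ} (Φ : ℝ → Phase d → Phase d) (T : ℝ) (p : Phase d) : ℝ :=
  (∑ j, ((Φ T p).1 j - p.1 j) ^ 2) + (∑ j, ((Φ T p).2 j - p.2 j) ^ 2)

/-- `p₀ ∈ T'ℝ^d` is absolutely `T`-periodic: the period defect vanishes to infinite
order at `p₀`. -/
def AbsPeriodic {d : ℕ} (Φ : ℝ → Phase d → Phase d) (T : ℝ) (p₀ : Phase d) : Prop :=
  p₀ ∈ Tprime d ∧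
  ∀ n : ℕ, iteratedFDerivWithin ℝ n (periodDefect Φ T) (Tprime d) p₀ = 0

open Metric Pointwise in
lemma null_of_zero {E F : Type*} [NormedAddCommGroup E] [NormedSpace ℝ E] [FiniteDimensional ℝ E]
    [MeasurableSpace E] [BorelSpace E] (μ : Measure E) [μ.IsAddHaarMeasure]
    [NormedAddCommGroup F] [NormedSpace ℝ F] (s : Set E) (f : E → F) (f' : E → E →L[ℝ] F)
    (hf : ∀ x ∈ s, f x = 0) (hf' : ∀ x ∈ s, HasFDerivWithinAt f (f' x) s x) :
    μ {x | x ∈ s ∧ f' x ≠ 0} = 0 := by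
  have hd := Besicovitch.ae_tendsto_measure_inter_div μ s
  rw [ae_iff] at hd
  refine measure_mono_null ?_ (le_antisymm ((Measure.le_restrict_apply _ _).trans hd.le) bot_le)
  rintro x ⟨xs, hx0⟩
  refine ⟨fun hx => hx0 ?_, xs⟩
  ext z
  rw [_root_.zero_apply, ← norm_le_zero_iff]
  suffices H : ∀ ε, 0 < ε → ‖f' x z‖ ≤ ε * (‖z‖ + ε) + ‖f' x‖ * ε by
    have :
      Tendsto (fun ε : ℝ => ε * (‖z‖ + ε) + ‖f' x‖ * ε) (𝓝[>] 0)
        (𝓝 (0 * (‖z‖ + 0) + ‖f' x‖ * 0)) :=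
      Tendsto.mono_left (Continuous.tendsto (by fun_prop) 0) nhdsWithin_le_nhds
    simp only [add_zero, mul_zero, zero_mul] at this
    apply le_of_tendsto_of_tendsto tendsto_const_nhds this
    filter_upwards [self_mem_nhdsWithin]
    exact H
  intro ε εpos
  have B₁ : ∀ᶠ r in 𝓝[>] (0 : ℝ), (s ∩ ({x} + r • closedBall z ε)).Nonempty :=
    Measure.eventually_nonempty_inter_smul_of_density_one μ s x hx _ measurableSet_closedBall
      (measure_closedBall_pos μ z εpos).ne'
  obtain ⟨ρ, ρpos, hρ⟩ :
    ∃ ρ > 0, ball x ρ ∩ s ⊆ {y : E | ‖f y - f x - (f' x) (y - x)‖ ≤ ε * ‖y - x‖} :=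
    mem_nhdsWithin_iff.1 ((hf' x xs).isLittleO.def εpos)
  have B₂ : ∀ᶠ r in 𝓝[>] (0 : ℝ), {x} + r • closedBall z ε ⊆ ball x ρ := by
    apply nhdsWithin_le_nhds
    exact eventually_singleton_add_smul_subset isBounded_closedBall (ball_mem_nhds x ρpos)
  obtain ⟨r, ⟨y, ⟨ys, hy⟩⟩, rρ, rpos⟩ :
    ∃ r : ℝ,
      (s ∩ ({x} + r • closedBall z ε)).Nonempty ∧ {x} + r • closedBall z ε ⊆ ball x ρ ∧ 0 < r :=
    (B₁.and (B₂.and self_mem_nhdsWithin)).exists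
  obtain ⟨a, az, ya⟩ : ∃ a, a ∈ closedBall z ε ∧ y = x + r • a := by
    simp only [mem_smul_set, image_add_left, mem_preimage, singleton_add] at hy
    rcases hy with ⟨a, az, ha⟩
    exact ⟨a, az, by simp only [ha, add_neg_cancel_left]⟩
  have h1 : ‖f y - f x - (f' x) (y - x)‖ ≤ ε * ‖y - x‖ := hρ ⟨rρ hy, ys⟩
  rw [hf y ys, hf x xs, ya] at h1
  simp only [sub_self, zero_sub, norm_neg, add_sub_cancel_left, map_smul, norm_smul,
    Real.norm_eq_abs, abs_of_pos rpos] at h1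
  have h2 : ‖f' x a‖ ≤ ε * ‖a‖ := by
    have : r * ‖f' x a‖ ≤ r * (ε * ‖a‖) := by linarith
    exact le_of_mul_le_mul_left this rpos
  have haz : ‖a - z‖ ≤ ε := by simpa [dist_eq_norm] using az
  have haz' : ‖z - a‖ ≤ ε := by rwa [norm_sub_rev]
  have h3 : ‖a‖ ≤ ‖z‖ + ε := by
    have := norm_add_le z (a - z); simp at this; linarith
  have h4 : ‖f' x (z - a)‖ ≤ ‖f' x‖ * ε := (f' x).le_opNorm_of_le haz'
  have h5 : f' x z = f' x a + f' x (z - a) := by simp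
  rw [h5]
  refine (norm_add_le _ _).trans (add_le_add (h2.trans ?_) h4)
  gcongr

lemma joint_smooth {E : Type*} [NormedAddCommGroup E] [NormedSpace ℝ E]
    (U : Set E) (f : ℝ → E → ℝ)
    (hf : ∀ t, ∀ p ∈ U, ContDiffAt ℝ (⊤ : ℕ∞) (Function.uncurry f) (t, p)) (n : ℕ) :
    ∀ t, ∀ p ∈ U, ContDiffAt ℝ (⊤ : ℕ∞) (fun q : ℝ × E => iteratedFDeriv ℝ n (f q.1) q.2) (t, p) := by
  induction n with
  | zero =>
    intro t p hp
    simp only [iteratedFDeriv_zero_eq_comp, Function.comp_def]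
    exact (LinearIsometryEquiv.contDiff _).contDiffAt.comp _ (hf t p hp)
  | succ n ih =>
    intro t p hp
    simp only [iteratedFDeriv_succ_eq_comp_left, Function.comp_def]
    have key : ContDiffAt ℝ (⊤ : ℕ∞)
        (fun q : ℝ × E => fderiv ℝ (iteratedFDeriv ℝ n (f q.1)) q.2) (t, p) := by
      refine ContDiffAt.fderiv (f := fun (q : ℝ × E) p => iteratedFDeriv ℝ n (f q.1) p)
        (g := Prod.snd) (n := (⊤ : ℕ∞)) ?_ contDiffAt_snd (by simp)
      exact ContDiffAt.comp (((t, p), p) : (ℝ × E) × E)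
        (f := fun q : (ℝ × E) × E => (q.1.1, q.2)) (ih t p hp) (by fun_prop)
    exact key.continuousLinearMap_comp
      ((continuousMultilinearCurryLeftEquiv ℝ (fun _ : Fin (n + 1) => E) ℝ).symm :
        _ →L[ℝ] E [×(n + 1)]→L[ℝ] ℝ)

lemma flat_ae {E : Type*} [NormedAddCommGroup E] [NormedSpace ℝ E] [FiniteDimensional ℝ E]
    [MeasurableSpace E] [BorelSpace E] (μ : Measure E) [μ.IsAddHaarMeasure]
    (U : Set E) (f : ℝ → E → ℝ)
    (hf : ∀ t, ∀ p ∈ U, ContDiffAt ℝ (⊤ : ℕ∞) (Function.uncurry f) (t, p))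
    (A : Set E) (hA : A ⊆ U) (τ : E → ℝ) (hτ : ∀ p ∈ A, HasFDerivWithinAt τ (0 : E →L[ℝ] ℝ) A p)
    (h0 : ∀ p ∈ A, f (τ p) p = 0) (n : ℕ) :
    μ {p | p ∈ A ∧ iteratedFDeriv ℝ n (f (τ p)) p ≠ 0} = 0 := by
  induction n with
  | zero =>
    convert measure_empty (μ := μ)
    ext p
    simp only [mem_ofPred_eq, mem_empty_iff_false, iff_false, not_and, not_not]
    intro hp
    ext m
    simp [h0 p hp]
  | succ n ih =>
    set B := {p | p ∈ A ∧ iteratedFDeriv ℝ n (f (τ p)) p = 0} with hB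
    have key := null_of_zero μ B (fun p => iteratedFDeriv ℝ n (f (τ p)) p)
      (fun p => fderiv ℝ (iteratedFDeriv ℝ n (f (τ p))) p) (fun p hp => hp.2) ?_
    · refine measure_mono_null ?_ (measure_union_null ih key)
      rintro p ⟨hp, hne⟩
      by_cases h : iteratedFDeriv ℝ n (f (τ p)) p = 0
      · right
        refine ⟨⟨hp, h⟩, fun hz => hne ?_⟩
        ext m
        rw [iteratedFDeriv_succ_apply_left, hz]
        simp
      · exact Or.inl ⟨hp, h⟩
    · rintro p ⟨hp, -⟩
      have hs := (joint_smooth U f hf n (τ p) p (hA hp)).differentiableAt (by simp)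
      have hK := hs.hasFDerivAt
      set K := fderiv ℝ (fun q : ℝ × E => iteratedFDeriv ℝ n (f q.1) q.2) (τ p, p)
      have h1 : HasFDerivAt (iteratedFDeriv ℝ n (f (τ p)))
          (K.comp ((0 : E →L[ℝ] ℝ).prod (ContinuousLinearMap.id ℝ E))) p :=
        HasFDerivAt.comp p (f := fun q : E => (τ p, q)) hK
          ((hasFDerivAt_const (τ p) p).prodMk (hasFDerivAt_id p))
      rw [h1.fderiv]
      have h2 : HasFDerivWithinAt (fun q : E => (τ q, q))
          ((0 : E →L[ℝ] ℝ).prod (ContinuousLinearMap.id ℝ E)) A p :=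
        (hτ p hp).prodMk (hasFDerivWithinAt_id p A)
      exact (HasFDerivAt.comp_hasFDerivWithinAt p (f := fun q : E => (τ q, q)) hK h2).mono (fun q hq => hq.1)

lemma Tprime_isOpen (d : ℕ) : IsOpen (Tprime d) :=
  isOpen_ne_fun continuous_snd continuous_const

lemma lin_expand {d : ℕ} (L : Phase d →L[ℝ] ℝ) (v : Phase d) :
    L v = (∑ j, v.1 j * L (Pi.single j 1, 0)) + ∑ j, v.2 j * L (0, Pi.single j 1) := by
  have h1 : v = (∑ j, v.1 j • ((Pi.single j 1, 0) : Phase d))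
      + ∑ j, v.2 j • ((0, Pi.single j 1) : Phase d) := by
    ext k <;> simp [Prod.fst_sum, Prod.snd_sum, Finset.sum_apply, Pi.single_apply]
  conv_lhs => rw [h1]
  simp only [map_add, map_sum, map_smul, smul_eq_mul]

lemma hh_contDiffAt {d : ℕ} {h : Phase d → ℝ} (hh : HomHamiltonian h) {p : Phase d}
    (hp : p ∈ Tprime d) : ContDiffAt ℝ (⊤ : ℕ∞) h p :=
  (hh.1 p hp).contDiffAt ((Tprime_isOpen d).mem_nhds hp)

lemma euler {d : ℕ} {h : Phase d → ℝ} (hh : HomHamiltonian h) {p : Phase d}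
    (hp : p ∈ Tprime d) : ∑ j, p.2 j * fderiv ℝ h p (0, Pi.single j 1) = h p := by
  have h1 := lin_expand (fderiv ℝ h p) (0, p.2)
  simp only [Pi.zero_apply, zero_mul, Finset.sum_const_zero, zero_add] at h1
  rw [← h1]
  have hd : HasFDerivAt h (fderiv ℝ h p) p :=
    ((hh_contDiffAt hh hp).differentiableAt (by simp)).hasFDerivAt
  have hc : HasDerivAt (fun c : ℝ => ((p.1, c • p.2) : Phase d)) (0, p.2) 1 := by
    have := (hasDerivAt_const (1 : ℝ) p.1).prodMk ((hasDerivAt_id (1 : ℝ)).smul_const p.2)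
    simpa using this
  have hd' : HasFDerivAt h (fderiv ℝ h p) ((p.1, (1 : ℝ) • p.2) : Phase d) := by simpa using hd
  have h2 := HasFDerivAt.comp_hasDerivAt (1 : ℝ) hd' hc
  have h3 : HasDerivAt (fun c : ℝ => c * h p) (h p) 1 := by
    simpa using (hasDerivAt_id (1 : ℝ)).mul_const (h p)
  have h4 : (fun c : ℝ => c * h p) =ᶠ[𝓝 1] (h ∘ fun c : ℝ => ((p.1, c • p.2) : Phase d)) := by
    filter_upwards [lt_mem_nhds (zero_lt_one (α := ℝ))] with c hc
    exact (hh.2.2 p hp c hc).symm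
  exact h2.unique (h3.congr_of_eventuallyEq h4.symm)

lemma two_le_top' : (2 : WithTop ℕ∞) ≤ ((⊤ : ℕ∞) : WithTop ℕ∞) :=
  WithTop.coe_le_coe.2 (le_top : (2 : ℕ∞) ≤ ⊤)

section flow
variable {d : ℕ} {h : Phase d → ℝ} {Φ : ℝ → Phase d → Phase d}

lemma flow_contDiffAt (hΦ : IsCompleteFlow h Φ) (t : ℝ) {p : Phase d} (hp : p ∈ Tprime d) :
    ContDiffAt ℝ (⊤ : ℕ∞) (fun q : ℝ × Phase d => Φ q.1 q.2) (t, p) :=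
  (hΦ.1 (t, p) ⟨mem_univ _, hp⟩).contDiffAt
    ((isOpen_univ.prod (Tprime_isOpen d)).mem_nhds ⟨mem_univ _, hp⟩)

lemma X_contDiffAt (hΦ : IsCompleteFlow h Φ) (t : ℝ) {p : Phase d} (hp : p ∈ Tprime d) (j : Fin d) :
    ContDiffAt ℝ (⊤ : ℕ∞) (fun q : ℝ × Phase d => (Φ q.1 q.2).1 j) (t, p) :=
  contDiffAt_pi.1 (contDiff_fst.contDiffAt.comp (t, p) (flow_contDiffAt hΦ t hp)) j

lemma Xi_contDiffAt (hΦ : IsCompleteFlow h Φ) (t : ℝ) {p : Phase d} (hp : p ∈ Tprime d) (j : Fin d) :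
    ContDiffAt ℝ (⊤ : ℕ∞) (fun q : ℝ × Phase d => (Φ q.1 q.2).2 j) (t, p) :=
  contDiffAt_pi.1 (contDiff_snd.contDiffAt.comp (t, p) (flow_contDiffAt hΦ t hp)) j

lemma hasDerivAt_line {G : Type*} [NormedAddCommGroup G] [NormedSpace ℝ G]
    {f : ℝ × Phase d → G} {t : ℝ} {p : Phase d} (hf : DifferentiableAt ℝ f (t, p)) :
    HasDerivAt (fun s => f (s, p)) (fderiv ℝ f (t, p) (1, 0)) t :=
  HasFDerivAt.comp_hasDerivAt t (f := fun s : ℝ => (s, p)) hf.hasFDerivAt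
    ((hasDerivAt_id t).prodMk (hasDerivAt_const t p))

lemma X_dt (hΦ : IsCompleteFlow h Φ) (t : ℝ) {p : Phase d} (hp : p ∈ Tprime d) (j : Fin d) :
    fderiv ℝ (fun q : ℝ × Phase d => (Φ q.1 q.2).1 j) (t, p) (1, 0)
      = fderiv ℝ h (Φ t p) (0, Pi.single j 1) := by
  have h1 := hasDerivAt_line ((X_contDiffAt hΦ t hp j).differentiableAt (by simp))
  have h2 := (hΦ.2 p hp).2.2.1 t (mem_univ _)
  exact h1.unique (hasDerivAt_pi.1 h2.fst j)

lemma Xi_dt (hΦ : IsCompleteFlow h Φ) (t : ℝ) {p : Phase d} (hp : p ∈ Tprime d) (j : Fin d) :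
    HasDerivAt (fun s => (Φ s p).2 j) (- fderiv ℝ h (Φ t p) (Pi.single j 1, 0)) t := by
  have h2 := (hΦ.2 p hp).2.2.1 t (mem_univ _)
  exact hasDerivAt_pi.1 h2.snd j

/-- symmetric second derivative -/
lemma X_mixed (hΦ : IsCompleteFlow h Φ) (t : ℝ) {p : Phase d} (hp : p ∈ Tprime d) (j : Fin d)
    (w : ℝ × Phase d) :
    HasDerivAt (fun s => fderiv ℝ (fun q : ℝ × Phase d => (Φ q.1 q.2).1 j) (s, p) w)
      (fderiv ℝ (fun q : ℝ × Phase d => fderiv ℝ h (Φ q.1 q.2) (0, Pi.single j 1)) (t, p) w) t := by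
  set X := (fun q : ℝ × Phase d => (Φ q.1 q.2).1 j) with hX
  have hc : ContDiffAt ℝ (⊤ : ℕ∞) X (t, p) := X_contDiffAt hΦ t hp j
  have hd : DifferentiableAt ℝ (fderiv ℝ X) (t, p) :=
    (hc.fderiv_right (m := (⊤ : ℕ∞)) (by simp)).differentiableAt (by simp)
  have h1 := (hasDerivAt_line hd).clm_apply (hasDerivAt_const t w)
  have hs : IsSymmSndFDerivAt ℝ X (t, p) := hc.isSymmSndFDerivAt (by simpa using two_le_top')
  have h3 : (fun q : ℝ × Phase d => fderiv ℝ h (Φ q.1 q.2) (0, Pi.single j 1)) =ᶠ[𝓝 (t, p)]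
      fun q => fderiv ℝ X q (1, 0) := by
    filter_upwards [(isOpen_univ.prod (Tprime_isOpen d)).mem_nhds (⟨mem_univ t, hp⟩ :
      (t, p) ∈ univ ×ˢ Tprime d)] with q hq
    exact (X_dt hΦ q.1 hq.2 j).symm
  rw [h3.fderiv_eq]
  have h4 := (hd.hasFDerivAt.clm_apply (hasFDerivAt_const ((1, 0) : ℝ × Phase d) (t, p))).fderiv
  rw [h4]
  refine h1.congr_deriv ?_
  have := hs.eq w (1, 0)
  simpa using this.symm

lemma invariance (hh : HomHamiltonian h) (hΦ : IsCompleteFlow h Φ) (t : ℝ) {p : Phase d}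
    (hp : p ∈ Tprime d) (v : Phase d) :
    ∑ j, (Φ t p).2 j * fderiv ℝ (fun q : ℝ × Phase d => (Φ q.1 q.2).1 j) (t, p) (0, v)
      = ∑ j, p.2 j * v.1 j := by
  set a : ℝ → ℝ := fun t =>
    ∑ j, (Φ t p).2 j * fderiv ℝ (fun q : ℝ × Phase d => (Φ q.1 q.2).1 j) (t, p) (0, v) with ha
  have hder : ∀ t, HasDerivAt a 0 t := by
    intro t
    have h1 : HasDerivAt a _ t := HasDerivAt.fun_sum (u := Finset.univ) (fun j _ =>
      (Xi_dt hΦ t hp j).mul (X_mixed hΦ t hp j (0, v)))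
    convert h1 using 1
    have hFp := (hΦ.2 p hp).2.1 t
    have hFd : HasFDerivAt (fun q : ℝ × Phase d => Φ q.1 q.2) _ (t, p) :=
      ((flow_contDiffAt hΦ t hp).differentiableAt (by simp)).hasFDerivAt
    have hhd : HasFDerivAt h (fderiv ℝ h (Φ t p)) (Φ t p) :=
      ((hh_contDiffAt hh hFp).differentiableAt (by simp)).hasFDerivAt
    have hXd : ∀ j, HasFDerivAt (fun q : ℝ × Phase d => (Φ q.1 q.2).1 j) _ (t, p) := fun j =>
      ((X_contDiffAt hΦ t hp j).differentiableAt (by simp)).hasFDerivAt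
    have hXid : ∀ j, HasFDerivAt (fun q : ℝ × Phase d => (Φ q.1 q.2).2 j) _ (t, p) := fun j =>
      ((Xi_contDiffAt hΦ t hp j).differentiableAt (by simp)).hasFDerivAt
    have hHd : ∀ j, HasFDerivAt
        (fun q : ℝ × Phase d => fderiv ℝ h (Φ q.1 q.2) (0, Pi.single j 1)) _ (t, p) := fun j => by
      have h2 : DifferentiableAt ℝ (fderiv ℝ h) (Φ t p) :=
        ((hh_contDiffAt hh hFp).fderiv_right (m := (⊤ : ℕ∞)) (by simp)).differentiableAt
          (by simp)
      have h3 : DifferentiableAt ℝ (fun q : ℝ × Phase d => fderiv ℝ h (Φ q.1 q.2)) (t, p) :=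
        DifferentiableAt.comp (t, p) (f := fun q : ℝ × Phase d => Φ q.1 q.2) h2
          hFd.differentiableAt
      exact (h3.clm_apply (differentiableAt_const _)).hasFDerivAt
    have e1 := HasFDerivAt.fun_sum (u := Finset.univ) (fun j _ => (hXid j).mul (hHd j))
    have e2 := HasFDerivAt.comp (t, p) (f := fun q : ℝ × Phase d => Φ q.1 q.2) hhd hFd
    have e3 : (h ∘ fun q : ℝ × Phase d => Φ q.1 q.2) =ᶠ[𝓝 (t, p)] fun q => ∑ j,
        (Φ q.1 q.2).2 j * fderiv ℝ h (Φ q.1 q.2) (0, Pi.single j 1) := by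
      filter_upwards [(isOpen_univ.prod (Tprime_isOpen d)).mem_nhds (⟨mem_univ t, hp⟩ :
        (t, p) ∈ univ ×ˢ Tprime d)] with q hq
      exact (euler hh ((hΦ.2 q.2 hq.2).2.1 q.1)).symm
    have e4 := DFunLike.congr_fun ((e1.congr_of_eventuallyEq e3).unique e2) ((0, v) : ℝ × Phase d)
    rw [ContinuousLinearMap.comp_apply, lin_expand] at e4
    have hX1 : ∀ j, (fderiv ℝ (fun q : ℝ × Phase d => Φ q.1 q.2) (t, p) (0, v)).1 j =
        fderiv ℝ (fun q : ℝ × Phase d => (Φ q.1 q.2).1 j) (t, p) (0, v) := fun j =>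
      (DFunLike.congr_fun ((hXd j).unique (hasFDerivAt_pi'.1 hFd.fst j)) (0, v)).symm
    have hX2 : ∀ j, (fderiv ℝ (fun q : ℝ × Phase d => Φ q.1 q.2) (t, p) (0, v)).2 j =
        fderiv ℝ (fun q : ℝ × Phase d => (Φ q.1 q.2).2 j) (t, p) (0, v) := fun j =>
      (DFunLike.congr_fun ((hXid j).unique (hasFDerivAt_pi'.1 hFd.snd j)) (0, v)).symm
    simp only [hX1, hX2] at e4
    simp [Finset.sum_add_distrib] at e4 ⊢
    have c1 : ∑ x, fderiv ℝ h (Φ t p) (0, Pi.single x 1) *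
          fderiv ℝ (fun q : ℝ × Phase d => (Φ q.1 q.2).2 x) (t, p) (0, v) =
        ∑ x, fderiv ℝ (fun q : ℝ × Phase d => (Φ q.1 q.2).2 x) (t, p) (0, v) *
          fderiv ℝ h (Φ t p) (0, Pi.single x 1) :=
      Finset.sum_congr rfl fun j _ => mul_comm _ _
    have c2 : ∑ x, fderiv ℝ h (Φ t p) (Pi.single x 1, 0) *
          fderiv ℝ (fun q : ℝ × Phase d => (Φ q.1 q.2).1 x) (t, p) (0, v) =
        ∑ x, fderiv ℝ (fun q : ℝ × Phase d => (Φ q.1 q.2).1 x) (t, p) (0, v) *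
          fderiv ℝ h (Φ t p) (Pi.single x 1, 0) :=
      Finset.sum_congr rfl fun j _ => mul_comm _ _
    linarith
  have hconst : a t = a 0 :=
    is_const_of_deriv_eq_zero (fun t => (hder t).differentiableAt) (fun t => (hder t).deriv) t 0
  change a t = _
  rw [hconst]
  refine Finset.sum_congr rfl fun j _ => ?_
  have hΦ0 := fun q hq => (hΦ.2 q hq).1
  rw [hΦ0 p hp]
  congr 1
  have h1 : HasFDerivAt (fun q : Phase d => (Φ 0 q).1 j) _ p :=
    HasFDerivAt.comp p (f := fun q : Phase d => ((0 : ℝ), q))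
      ((X_contDiffAt hΦ 0 hp j).differentiableAt (by simp)).hasFDerivAt
      ((hasFDerivAt_const (0 : ℝ) p).prodMk (hasFDerivAt_id p))
  have h2 : HasFDerivAt (fun q : Phase d => q.1 j) _ p :=
    hasFDerivAt_pi'.1 (hasFDerivAt_fst (𝕜 := ℝ) (p := p)) j
  have h3 : (fun q : Phase d => q.1 j) =ᶠ[𝓝 p] (fun q : Phase d => (Φ 0 q).1 j) := by
    filter_upwards [(Tprime_isOpen d).mem_nhds hp] with q hq
    rw [hΦ0 q hq]
  simpa using DFunLike.congr_fun ((h1.congr_of_eventuallyEq h3).unique h2) v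

def psi (Φ : ℝ → Phase d → Phase d) (q : ℝ × Phase d) : ℝ :=
  ∑ j, q.2.2 j * ((Φ q.1 q.2).1 j - q.2.1 j)

lemma psi_contDiffAt (hΦ : IsCompleteFlow h Φ) (t : ℝ) {p : Phase d} (hp : p ∈ Tprime d) :
    ContDiffAt ℝ (⊤ : ℕ∞) (psi Φ) (t, p) := by
  unfold psi
  refine ContDiffAt.sum fun j _ => ContDiffAt.mul (by fun_prop)
    ((X_contDiffAt hΦ t hp j).sub (by fun_prop))

lemma psi_zero {t : ℝ} {p : Phase d} (hper : Φ t p = p) : psi Φ (t, p) = 0 := by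
  simp [psi, hper]

lemma psi_hasFDerivAt (hh : HomHamiltonian h) (hΦ : IsCompleteFlow h Φ) {t : ℝ} {p : Phase d}
    (hp : p ∈ Tprime d) (hper : Φ t p = p) :
    HasFDerivAt (psi Φ) (h p • ContinuousLinearMap.fst ℝ ℝ (Phase d)) (t, p) := by
  have hXd : ∀ j, HasFDerivAt (fun q : ℝ × Phase d => (Φ q.1 q.2).1 j) _ (t, p) := fun j =>
    ((X_contDiffAt hΦ t hp j).differentiableAt (by simp)).hasFDerivAt
  have h1 : ∀ j, HasFDerivAt (fun q : ℝ × Phase d => q.2.1 j) _ (t, p) := fun j =>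
    hasFDerivAt_pi'.1 (hasFDerivAt_snd (𝕜 := ℝ) (p := (t, p))).fst j
  have h2 : ∀ j, HasFDerivAt (fun q : ℝ × Phase d => q.2.2 j) _ (t, p) := fun j =>
    hasFDerivAt_pi'.1 (hasFDerivAt_snd (𝕜 := ℝ) (p := (t, p))).snd j
  have e : HasFDerivAt (psi Φ) _ (t, p) :=
    HasFDerivAt.fun_sum (u := Finset.univ) (fun j _ => (h2 j).mul ((hXd j).sub (h1 j)))
  refine e.congr_fderiv ?_
  refine ContinuousLinearMap.ext fun w => ?_
  obtain ⟨s, v⟩ := w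
  have i1 := invariance hh hΦ t hp v
  have i2 := euler hh hp
  have i3 : ∀ j, fderiv ℝ (fun q : ℝ × Phase d => (Φ q.1 q.2).1 j) (t, p) (s, v) =
      s * fderiv ℝ h p (0, Pi.single j 1) +
      fderiv ℝ (fun q : ℝ × Phase d => (Φ q.1 q.2).1 j) (t, p) (0, v) := by
    intro j
    have := X_dt hΦ t hp j
    rw [hper] at this
    have e : ((s, v) : ℝ × Phase d) = s • ((1, 0) : ℝ × Phase d) + (0, v) := by simp
    rw [e, map_add, map_smul, this]; rfl
  rw [hper] at i1
  simp [hper, i3, mul_add, mul_sub, Finset.sum_add_distrib, i1, mul_left_comm _ s, ← Finset.mul_sum, i2]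
  ring

lemma periodDefect_smooth (hΦ : IsCompleteFlow h Φ) (t : ℝ) {p : Phase d} (hp : p ∈ Tprime d) :
    ContDiffAt ℝ (⊤ : ℕ∞) (Function.uncurry (periodDefect Φ)) (t, p) := by
  have : Function.uncurry (periodDefect Φ) = fun q : ℝ × Phase d =>
      (∑ j, ((Φ q.1 q.2).1 j - q.2.1 j) ^ 2) + (∑ j, ((Φ q.1 q.2).2 j - q.2.2 j) ^ 2) := rfl
  rw [this]
  refine ContDiffAt.add (ContDiffAt.sum fun j _ => ?_) (ContDiffAt.sum fun j _ => ?_)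
  · exact ((X_contDiffAt hΦ t hp j).sub (by fun_prop)).pow 2
  · exact ((Xi_contDiffAt hΦ t hp j).sub (by fun_prop)).pow 2

lemma local_null (hh : HomHamiltonian h) (hΦ : IsCompleteFlow h Φ) {t₀ : ℝ} {p₀ : Phase d}
    (hp₀ : p₀ ∈ Tprime d) (hper : Φ t₀ p₀ = p₀) :
    ∃ N ∈ 𝓝 (t₀, p₀), volume {p : Phase d | p ∈ Tprime d ∧
      ∃ t : ℝ, (t, p) ∈ N ∧ Φ t p = p ∧ ¬ AbsPeriodic Φ t p} = 0 := by
  have hc : 0 < h p₀ := hh.2.1 p₀ hp₀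
  set c := h p₀ with hcdef
  have hs : HasStrictFDerivAt (psi Φ) (c • ContinuousLinearMap.fst ℝ ℝ (Phase d)) (t₀, p₀) :=
    (psi_contDiffAt hΦ t₀ hp₀).hasStrictFDerivAt' (psi_hasFDerivAt hh hΦ hp₀ hper) (by simp)
  have hev := hs.isLittleO.def (half_pos hc)
  rw [nhds_prod_eq] at hev
  obtain ⟨M, hM, hM'⟩ := Filter.mem_prod_same_iff.1 hev
  obtain ⟨I, hI, V, hV, hIV⟩ := mem_nhds_prod_iff.1 hM
  have est : ∀ t ∈ I, ∀ s ∈ I, ∀ q ∈ V, |t - s| ≤ 2 / c * |psi Φ (t, q) - psi Φ (s, q)| := by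
    intro t ht s hs q hq
    have h1 : ‖psi Φ (t, q) - psi Φ (s, q) - (c • ContinuousLinearMap.fst ℝ ℝ (Phase d))
        ((t, q) - (s, q))‖ ≤ c / 2 * ‖((t, q) : ℝ × Phase d) - (s, q)‖ :=
      hM' (⟨hIV ⟨ht, hq⟩, hIV ⟨hs, hq⟩⟩ : ((t, q), (s, q)) ∈ M ×ˢ M)
    simp [Prod.norm_def] at h1
    have h2 : c * |t - s| ≤ |psi Φ (t, q) - psi Φ (s, q)| + c / 2 * |t - s| := by
      have h3 := abs_sub_abs_le_abs_sub (c * (t - s)) (psi Φ (t, q) - psi Φ (s, q))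
      rw [abs_sub_comm (c * (t - s)), abs_mul, abs_of_pos hc] at h3
      linarith
    rw [div_mul_eq_mul_div, le_div_iff₀ hc]
    linarith
  set A : Set (Phase d) := {p | p ∈ Tprime d ∧ p ∈ V ∧ ∃ t ∈ I, Φ t p = p} with hA
  have hch : ∀ p, ∃ t, p ∈ A → t ∈ I ∧ Φ t p = p := by
    intro p
    by_cases hp : p ∈ A
    · obtain ⟨t, ht⟩ := hp.2.2
      exact ⟨t, fun _ => ht⟩
    · exact ⟨0, fun h => absurd h hp⟩
  choose τ hτ using hch
  have hτd : ∀ p ∈ A, HasFDerivWithinAt τ (0 : Phase d →L[ℝ] ℝ) A p := by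
    intro p hp
    have g1 : HasFDerivAt (fun q => psi Φ (τ p, q)) (0 : Phase d →L[ℝ] ℝ) p := by
      have := HasFDerivAt.comp p (f := fun q : Phase d => (τ p, q))
        (psi_hasFDerivAt hh hΦ hp.1 (hτ p hp).2)
        ((hasFDerivAt_const (τ p) p).prodMk (hasFDerivAt_id p))
      refine this.congr_fderiv ?_
      refine ContinuousLinearMap.ext fun w => ?_
      simp
    have g2 := g1.isLittleO.mono (nhdsWithin_le_nhds (s := A))
    refine HasFDerivWithinAt.of_isLittleO ?_
    refine Asymptotics.IsBigO.trans_isLittleO ?_ g2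
    refine Asymptotics.IsBigO.of_bound (2 / c) ?_
    filter_upwards [self_mem_nhdsWithin] with q hq
    have := est (τ q) (hτ q hq).1 (τ p) (hτ p hp).1 q hq.2.1
    rw [psi_zero (hτ q hq).2, zero_sub, abs_neg] at this
    simpa [psi_zero (hτ p hp).2] using this
  refine ⟨I ×ˢ V, prod_mem_nhds hI hV, ?_⟩
  have : (volume : Measure (Phase d)).IsAddHaarMeasure :=
    Measure.prod.instIsAddHaarMeasure (volume : Measure (Fin d → ℝ)) (volume : Measure (Fin d → ℝ))
  have key := fun n => flat_ae volume (Tprime d) (periodDefect Φ)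
    (fun t p hp => periodDefect_smooth hΦ t hp) A (fun p hp => hp.1) τ hτd
    (fun p hp => by simp [periodDefect, (hτ p hp).2]) n
  refine measure_mono_null ?_ (measure_iUnion_null key)
  rintro p ⟨hp, t, ⟨htI, hpV⟩, hper, hna⟩
  have hpA : p ∈ A := ⟨hp, hpV, t, htI, hper⟩
  have ht : t = τ p := by
    have := est t htI (τ p) (hτ p hpA).1 p hpV
    rw [psi_zero (hτ p hpA).2, psi_zero hper] at this
    simp at this
    linarith
  simp only [AbsPeriodic, not_and, not_forall] at hna
  obtain ⟨n, hn⟩ := hna hp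
  rw [iteratedFDerivWithin_of_isOpen n (Tprime_isOpen d) hp, ht] at hn
  exact mem_iUnion.2 ⟨n, hpA, hn⟩
end flow

/-- The set of points which are `T`-periodic but not absolutely `T`-periodic for some
`T > 0` has Lebesgue measure zero. -/
theorem periodic_not_absPeriodic_measure_zero {d : ℕ} (h : Phase d → ℝ)
    (hh : HomHamiltonian h) (Φ : ℝ → Phase d → Phase d) (hΦ : IsCompleteFlow h Φ) :
    volume {p : Phase d | p ∈ Tprime d ∧
      ∃ T : ℝ, 0 < T ∧ Φ T p = p ∧ ¬ AbsPeriodic Φ T p} = 0 := by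
  set S : Set (ℝ × Phase d) := {q | q.2 ∈ Tprime d ∧ Φ q.1 q.2 = q.2} with hS
  have hl : ∀ q : ℝ × Phase d, ∃ N : Set (ℝ × Phase d), q ∈ S → N ∈ 𝓝 q ∧
      volume {p : Phase d | p ∈ Tprime d ∧
        ∃ t : ℝ, (t, p) ∈ N ∧ Φ t p = p ∧ ¬ AbsPeriodic Φ t p} = 0 := by
    intro q
    by_cases hq : q ∈ S
    · obtain ⟨N, hN, hN'⟩ := local_null hh hΦ hq.1 hq.2
      exact ⟨N, fun _ => ⟨hN, hN'⟩⟩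
    · exact ⟨∅, fun h => absurd h hq⟩
  choose N hN using hl
  obtain ⟨C, hCS, hCc, hC⟩ := TopologicalSpace.countable_cover_nhdsWithin (f := N) (s := S)
    (fun q hq => mem_nhdsWithin_of_mem_nhds (hN q hq).1)
  refine measure_mono_null ?_ ((measure_biUnion_null_iff hCc).2 fun q hq => (hN q (hCS hq)).2)
  rintro p ⟨hp, T, -, hper, hna⟩
  have hmem : (T, p) ∈ S := ⟨hp, hper⟩
  obtain ⟨q, hq, hqN⟩ := mem_iUnion₂.1 (hC hmem)
  exact mem_iUnion₂.2 ⟨q, hq, hp, T, hqN, hper, hna⟩
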